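/- arXiv:2009.08806 — 2 statements merged into one kernel-verified Lean document; each statement's English description precedes it below -/
import Mathlib

section
/- Under the (P4+kP3)-free setup, suppose that no minimum total dominating set of G contains a P3, and let D be a minimum total dominating set of G. Then at most (k+1)(k+|A|)−1 of the B-edges of D have no private neighbor in C, where a B-edge xy of D has no private neighbor in C if no vertex of C is a private neighbor of x or of y with respect to D. -/
open SimpleGraph

namespace TD

variable {V : Type*} {α β : Type*}

/-- `D` is a total dominating set of `G`: every vertex has a neighbor in `D`. -/
def IsTotalDomSet (G : SimpleGraph V) (D : Set V) : Prop :=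
  ∀ v : V, ∃ u ∈ D, G.Adj v u

/-- The total domination number `γ_t(G)`. -/
noncomputable def totalDomNum (G : SimpleGraph V) : ℕ :=
  sInf {m : ℕ | ∃ D : Set V, IsTotalDomSet G D ∧ D.ncard = m}

/-- A minimum total dominating set. -/
def IsMinTotalDomSet (G : SimpleGraph V) (D : Set V) : Prop :=
  IsTotalDomSet G D ∧ D.ncard = totalDomNum G

/-- `S` contains a `P3`: three distinct vertices `a, b, c ∈ S` with `ab, bc ∈ E(G)`. -/
def HasP3 (G : SimpleGraph V) (S : Set V) : Prop :=
  ∃ a b c : V, a ∈ S ∧ b ∈ S ∧ c ∈ S ∧ a ≠ b ∧ b ≠ c ∧ a ≠ c ∧ G.Adj a b ∧ G.Adj b c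

/-- `D` is a dominating set of `G`. -/
def IsDomSet (G : SimpleGraph V) (D : Set V) : Prop :=
  ∀ v ∉ D, ∃ u ∈ D, G.Adj v u

/-- The domination number `γ(G)`. -/
noncomputable def domNum (G : SimpleGraph V) : ℕ :=
  sInf {m : ℕ | ∃ D : Set V, IsDomSet G D ∧ D.ncard = m}

/-- The (open) neighborhood of a set `S`: union of the neighborhoods of its members. -/
def nbhd (G : SimpleGraph V) (S : Set V) : Set V :=
  {v | ∃ u ∈ S, G.Adj u v}

/-- The closed neighborhood `N[S]`. -/
def closedNbhd (G : SimpleGraph V) (S : Set V) : Set V :=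
  S ∪ nbhd G S

/-- Distance between two sets of vertices. -/
noncomputable def setDist (G : SimpleGraph V) (S T : Set V) : ℕ :=
  sInf {m : ℕ | ∃ u ∈ S, ∃ v ∈ T, G.dist u v = m}

/-- `k` disjoint copies of `H`. -/
def kCopies (k : ℕ) (H : SimpleGraph α) : SimpleGraph (Fin k × α) where
  Adj p q := p.1 = q.1 ∧ H.Adj p.2 q.2
  symm := ⟨fun _ _ h => ⟨h.1.symm, h.2.symm⟩⟩
  loopless := ⟨fun p h => H.loopless.irrefl p.2 h.2⟩

/-- The graph `P4 + k·P3`. -/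
def p4kp3 (k : ℕ) : SimpleGraph (Fin 4 ⊕ (Fin k × Fin 3)) :=
  (pathGraph 4) ⊕g (kCopies k (pathGraph 3))

/-- `G` contains no induced copy of `H` (`G` is `H`-free). -/
def IndFree (G : SimpleGraph V) (H : SimpleGraph α) : Prop :=
  ¬ Nonempty (H ↪g G)

/-- `K` is a maximal clique of the subgraph of `G` induced by `C`. -/
def IsMaxCliqueWithin (G : SimpleGraph V) (C K : Set V) : Prop :=
  K ⊆ C ∧ G.IsClique K ∧ ∀ K' : Set V, K' ⊆ C → G.IsClique K' → K ⊆ K' → K' = K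

/-- Member of `𝒦'`: a maximal clique of `G[C]` whose closed neighborhood contains no
induced `P4` and such that no vertex of `B` is adjacent to all of its vertices. -/
def GoodClique (G : SimpleGraph V) (B C K : Set V) : Prop :=
  IsMaxCliqueWithin G C K ∧
    IndFree (G.induce (closedNbhd G K)) (pathGraph 4) ∧
    ¬ ∃ b ∈ B, ∀ x ∈ K, G.Adj b x

/-- A regular clique: a member of `𝒦'` for which there are `k` other members of `𝒦'`
pairwise at distance at least four from one another and from it. -/
def RegularClique (G : SimpleGraph V) (k : ℕ) (B C K : Set V) : Prop :=
  GoodClique G B C K ∧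
    ∃ Ks : Fin k → Set V,
      (∀ i, GoodClique G B C (Ks i)) ∧
      (∀ i, 4 ≤ setDist G K (Ks i)) ∧
      ∀ i j : Fin k, i ≠ j → 4 ≤ setDist G (Ks i) (Ks j)

/-- `w` is a private neighbor of `v` with respect to `D`: `N(w) ∩ D = {v}`. -/
def IsPrivateNbr (G : SimpleGraph V) (D : Set V) (v w : V) : Prop :=
  {u | u ∈ D ∧ G.Adj w u} = {v}

end TD

open TD SimpleGraph

namespace TD

variable {V : Type*}

theorem totalDomNum_le {G : SimpleGraph V} {D : Set V} (hD : IsTotalDomSet G D) :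
    totalDomNum G ≤ D.ncard :=
  Nat.sInf_le ⟨D, hD, rfl⟩

theorem exists_adj_p4kp3 (k : ℕ) (p : Fin 4 ⊕ (Fin k × Fin 3)) : ∃ q, (p4kp3 k).Adj p q := by
  have h4 : ∀ a : Fin 4, ∃ b, (pathGraph 4).Adj a b := by simp only [pathGraph_adj]; decide
  have h3 : ∀ a : Fin 3, ∃ b, (pathGraph 3).Adj a b := by simp only [pathGraph_adj]; decide
  rcases p with a | ⟨i, a⟩
  · obtain ⟨b, hb⟩ := h4 a
    exact ⟨Sum.inl b, hb⟩
  · obtain ⟨b, hb⟩ := h3 a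
    exact ⟨Sum.inr (i, b), rfl, hb⟩

/-- `P4 + kP3` is an induced subgraph of `(k+1)P4`. -/
def p4kp3EmbeddingKCopies (k : ℕ) : p4kp3 k ↪g kCopies (k + 1) (pathGraph 4) where
  toFun := Sum.elim (fun a => (0, a)) (fun p => (p.1.succ, p.2.castSucc))
  inj' := by
    rintro (a | ⟨i, a⟩) (b | ⟨j, b⟩) h
    · simpa using h
    · exact absurd (congrArg Prod.fst h).symm (Fin.succ_ne_zero j)
    · exact absurd (congrArg Prod.fst h) (Fin.succ_ne_zero i)
    · simpa using h
  map_rel_iff' := by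
    rintro (a | ⟨i, a⟩) (b | ⟨j, b⟩)
    · change (0 : Fin (k + 1)) = 0 ∧ (pathGraph 4).Adj a b ↔ (pathGraph 4).Adj a b
      simp
    · exact iff_of_false (fun h => Fin.succ_ne_zero j h.1.symm) (by simp [p4kp3])
    · exact iff_of_false (fun h => Fin.succ_ne_zero i h.1) (by simp [p4kp3])
    · change i.succ = j.succ ∧ (pathGraph 4).Adj a.castSucc b.castSucc ↔
        i = j ∧ (pathGraph 3).Adj a b
      simp [pathGraph_adj]

/-- A map reflecting and preserving adjacency from disjoint copies of `P4` is automatically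
injective, because distinct vertices have distinct neighborhoods. -/
theorem nonempty_kCopies_embedding {G : SimpleGraph V} {m : ℕ} (f : Fin m × Fin 4 → V)
    (hf : ∀ p q, G.Adj (f p) (f q) ↔ p.1 = q.1 ∧ (pathGraph 4).Adj p.2 q.2) :
    Nonempty (kCopies m (pathGraph 4) ↪g G) := by
  refine ⟨⟨⟨f, ?_⟩, fun {p q} => hf p q⟩⟩
  have hex : ∀ a : Fin 4, ∃ b, (pathGraph 4).Adj a b := by simp only [pathGraph_adj]; decide
  have htwin : ∀ a b : Fin 4,
      (∀ c, (pathGraph 4).Adj a c ↔ (pathGraph 4).Adj b c) → a = b := by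
    simp only [pathGraph_adj]; decide
  rintro ⟨i, a⟩ ⟨j, b⟩ h
  have key : ∀ r : Fin m × Fin 4, (i = r.1 ∧ (pathGraph 4).Adj a r.2) ↔
      (j = r.1 ∧ (pathGraph 4).Adj b r.2) := fun r => by
    rw [← hf (i, a) r, h, hf (j, b) r]
  obtain ⟨c, hc⟩ := hex a
  obtain rfl : j = i := ((key (i, c)).1 ⟨rfl, hc⟩).1
  rw [htwin a b fun c => by simpa using key (j, c)]

/-- Disjoint, pairwise anticomplete induced paths `x y w z` form an induced `(m)P4`. -/
theorem nonempty_kCopies_embedding_of_paths {G : SimpleGraph V} {m : ℕ} (x y w z : Fin m → V)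
    (hxx : ∀ i j, ¬ G.Adj (x i) (x j)) (hxy : ∀ i j, G.Adj (x i) (y j) ↔ i = j)
    (hxw : ∀ i j, ¬ G.Adj (x i) (w j)) (hxz : ∀ i j, ¬ G.Adj (x i) (z j))
    (hyy : ∀ i j, ¬ G.Adj (y i) (y j)) (hyw : ∀ i j, G.Adj (y i) (w j) ↔ i = j)
    (hyz : ∀ i j, ¬ G.Adj (y i) (z j)) (hww : ∀ i j, ¬ G.Adj (w i) (w j))
    (hwz : ∀ i j, G.Adj (w i) (z j) ↔ i = j) (hzz : ∀ i j, ¬ G.Adj (z i) (z j)) :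
    Nonempty (kCopies m (pathGraph 4) ↪g G) := by
  refine nonempty_kCopies_embedding (fun p => ![x p.1, y p.1, w p.1, z p.1] p.2) ?_
  rintro ⟨i, a⟩ ⟨j, b⟩
  have hyx : ∀ i j, G.Adj (y i) (x j) ↔ i = j := fun i j => by rw [G.adj_comm, hxy, eq_comm]
  have hwx : ∀ i j, ¬ G.Adj (w i) (x j) := fun i j h => hxw _ _ h.symm
  have hzx : ∀ i j, ¬ G.Adj (z i) (x j) := fun i j h => hxz _ _ h.symm
  have hwy : ∀ i j, G.Adj (w i) (y j) ↔ i = j := fun i j => by rw [G.adj_comm, hyw, eq_comm]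
  have hzy : ∀ i j, ¬ G.Adj (z i) (y j) := fun i j h => hyz _ _ h.symm
  have hzw : ∀ i j, G.Adj (z i) (w j) ↔ i = j := fun i j => by rw [G.adj_comm, hwz, eq_comm]
  fin_cases a <;> fin_cases b <;> simp [pathGraph_adj, *]

/-- If no minimum total dominating set contains a `P3`, deleting a large part `S` from a minimum
total dominating set `D` leaves a vertex of `C`, all of whose neighbors in `D` belong to `S`,
that is not adjacent to any prescribed vertex of the small set `W`. -/
theorem exists_nbrs_subset_not_adj [Finite V] {G : SimpleGraph V} {k : ℕ} {A C D S W : Set V}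
    (hAP3 : HasP3 G A) (hA : ∀ v ∉ C, ∃ a ∈ A, G.Adj v a)
    (hnoP3 : ∀ D' : Set V, IsMinTotalDomSet G D' → ¬ HasP3 G D')
    (hD : IsMinTotalDomSet G D) (hSD : S ⊆ D) (hS : k + A.ncard ≤ S.ncard)
    (hW : W.ncard ≤ k) :
    ∃ w ∈ C, (∀ u ∈ D, G.Adj w u → u ∈ S) ∧ ∀ v ∈ W, ¬ G.Adj w v := by
  by_contra! hcon
  have htot : IsTotalDomSet G ((D \ S) ∪ (A ∪ W)) := by
    intro v
    by_cases hv : v ∈ C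
    · by_cases hb : ∀ u ∈ D, G.Adj v u → u ∈ S
      · obtain ⟨u, hu, huv⟩ := hcon v hv hb
        exact ⟨u, Or.inr (Or.inr hu), huv⟩
      · push Not at hb
        obtain ⟨u, hu, huv, huS⟩ := hb
        exact ⟨u, Or.inl ⟨hu, huS⟩, huv⟩
    · obtain ⟨a, ha, hva⟩ := hA v hv
      exact ⟨a, Or.inr (Or.inl ha), hva⟩
  have hle : ((D \ S) ∪ (A ∪ W)).ncard ≤ totalDomNum G := by
    have h1 := Set.ncard_union_le (D \ S) (A ∪ W)
    have h2 := Set.ncard_union_le A W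
    have h3 := Set.ncard_sdiff_add_ncard_of_subset hSD
    have h4 := hD.2
    omega
  refine hnoP3 _ ⟨htot, hle.antisymm (totalDomNum_le htot)⟩ ?_
  obtain ⟨a, b, c, ha, hb, hc, h⟩ := hAP3
  exact ⟨a, b, c, Or.inr (Or.inl ha), Or.inr (Or.inl hb), Or.inr (Or.inl hc), h⟩

/-- Given `k + 1` large parts of `D`, there are pairwise nonadjacent vertices of
`C`, one for each part, whose neighbors in `D` all belong to that part. -/
theorem exists_independent_representatives [Finite V] [Nonempty V] {G : SimpleGraph V} {k : ℕ}
    {A C D : Set V} (S : Fin (k + 1) → Set V)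
    (hAP3 : HasP3 G A) (hA : ∀ v ∉ C, ∃ a ∈ A, G.Adj v a)
    (hnoP3 : ∀ D' : Set V, IsMinTotalDomSet G D' → ¬ HasP3 G D')
    (hD : IsMinTotalDomSet G D) (hSD : ∀ i, S i ⊆ D) (hS : ∀ i, k + A.ncard ≤ (S i).ncard) :
    ∃ w : Fin (k + 1) → V, (∀ i, w i ∈ C ∧ ∀ u ∈ D, G.Adj (w i) u → u ∈ S i) ∧
      ∀ i j, ¬ G.Adj (w i) (w j) := by
  suffices h : ∀ T : Finset (Fin (k + 1)), ∃ w : Fin (k + 1) → V,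
      (∀ i ∈ T, w i ∈ C ∧ ∀ u ∈ D, G.Adj (w i) u → u ∈ S i) ∧
      ∀ i ∈ T, ∀ j ∈ T, ¬ G.Adj (w i) (w j) by
    simpa using h Finset.univ
  intro T
  induction T using Finset.induction_on with
  | empty => exact ⟨fun _ => Classical.arbitrary V, by simp, by simp⟩
  | insert i T hi ih =>
    obtain ⟨w, hw, hww⟩ := ih
    have hcard : (w '' (T : Set (Fin (k + 1)))).ncard ≤ k := by
      have h1 := Set.ncard_image_le (f := w) (Set.toFinite (T : Set (Fin (k + 1))))
      have h2 := Finset.card_le_univ (insert i T)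
      rw [Finset.card_insert_of_notMem hi, Fintype.card_fin] at h2
      rw [Set.ncard_coe_finset] at h1
      omega
    obtain ⟨v, hvC, hvS, hvW⟩ := exists_nbrs_subset_not_adj hAP3 hA hnoP3 hD (hSD i) (hS i) hcard
    have hup : ∀ j ∈ T, Function.update w i v j = w j := fun j hj =>
      Function.update_of_ne (ne_of_mem_of_not_mem hj hi) _ _
    have hvW' : ∀ j ∈ T, ¬ G.Adj v (w j) := fun j hj => hvW _ ⟨j, hj, rfl⟩
    refine ⟨Function.update w i v, ?_, ?_⟩
    · intro j hj
      rcases Finset.mem_insert.1 hj with rfl | hj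
      · simpa using ⟨hvC, hvS⟩
      · rw [hup j hj]; exact hw j hj
    · intro a ha b hb
      rcases Finset.mem_insert.1 ha with hai | haT <;> rcases Finset.mem_insert.1 hb with hbi | hbT
      · rw [hai, hbi]; exact G.loopless.irrefl _
      · rw [hai, hup b hbT, Function.update_self]; exact hvW' b hbT
      · rw [hbi, hup a haT, Function.update_self]; exact fun h => hvW' a haT h.symm
      · rw [hup a haT, hup b hbT]; exact hww a haT b hbT

end TD

theorem stmt12 {V : Type*} [Fintype V] (k : ℕ) (hk : 1 ≤ k)
    (G : SimpleGraph V) (hconn : G.Connected) (hfree : IndFree G (p4kp3 k))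
    (A B C : Set V) (hA : Nonempty (G.induce A ≃g p4kp3 (k - 1)))
    (hB : B = {v | v ∉ A ∧ ∃ a ∈ A, G.Adj v a})
    (hC : C = {v | v ∉ A ∧ v ∉ B})
    (hnoP3 : ∀ D' : Set V, IsMinTotalDomSet G D' → ¬ HasP3 G D')
    (D : Set V) (hD : IsMinTotalDomSet G D) :
    ({e : Sym2 V | ∃ x y : V, e = s(x, y) ∧ G.Adj x y ∧ x ∈ D ∧ y ∈ D ∧ x ∈ B ∧ y ∈ B ∧
        ¬ ∃ w ∈ C, IsPrivateNbr G D x w ∨ IsPrivateNbr G D y w}).ncard ≤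
      (k + 1) * (k + A.ncard) - 1 := by
  have := hconn.nonempty
  obtain ⟨φ⟩ := hA
  have hAP3 : HasP3 G A := by
    have hadj : ∀ p q, (p4kp3 (k - 1)).Adj p q → G.Adj (φ.symm p : V) (φ.symm q) :=
      fun p q h => φ.symm.map_adj_iff.2 h
    have hne : (φ.symm (Sum.inl 0) : V) ≠ φ.symm (Sum.inl 2) := fun h => by
      simpa using φ.symm.injective (Subtype.ext h)
    have h01 := hadj (Sum.inl 0) (Sum.inl 1) (by simp [p4kp3, pathGraph_adj])
    have h12 := hadj (Sum.inl 1) (Sum.inl 2) (by simp [p4kp3, pathGraph_adj])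
    exact ⟨_, _, _, Subtype.prop _, Subtype.prop _, Subtype.prop _, h01.ne, h12.ne, hne, h01, h12⟩
  have hAdom : ∀ v ∉ C, ∃ a ∈ A, G.Adj v a := by
    intro v hv
    by_cases hvA : v ∈ A
    · obtain ⟨q, hq⟩ := exists_adj_p4kp3 (k - 1) (φ ⟨v, hvA⟩)
      refine ⟨φ.symm q, Subtype.prop _, ?_⟩
      have : (G.induce A).Adj ⟨v, hvA⟩ (φ.symm q) := by
        rw [← φ.map_adj_iff]; simpa using hq
      exact this
    · have hvB : v ∈ B := by
        by_contra hvB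
        exact hv (by rw [hC]; exact ⟨hvA, hvB⟩)
      rw [hB] at hvB
      exact hvB.2
  have hmatch : ∀ a ∈ D, ∀ b ∈ D, ∀ c ∈ D, G.Adj a b → G.Adj b c → a = c := by
    intro a ha b hb c hc hab hbc
    by_contra hac
    exact hnoP3 D hD ⟨a, b, c, ha, hb, hc, hab.ne, hbc.ne, hac, hab, hbc⟩
  set E := {e : Sym2 V | ∃ x y : V, e = s(x, y) ∧ G.Adj x y ∧ x ∈ D ∧ y ∈ D ∧ x ∈ B ∧ y ∈ B ∧
        ¬ ∃ w ∈ C, IsPrivateNbr G D x w ∨ IsPrivateNbr G D y w}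
  by_contra hlt
  have hcard : Nat.card (Fin (k + 1) × Fin (k + A.ncard)) ≤ Nat.card E := by
    rw [Nat.card_prod, Nat.card_fin, Nat.card_fin, Nat.card_coe_set_eq]
    omega
  obtain ⟨g⟩ : Nonempty (Fin (k + 1) × Fin (k + A.ncard) ↪ E) := by
    have := Fintype.ofFinite E
    rw [Nat.card_eq_fintype_card, Nat.card_eq_fintype_card] at hcard
    exact Function.Embedding.nonempty_of_card_le hcard
  choose x y hxy hadj hxD hyD hxB hyB hpriv using fun p => (g p).2
  have hinj : ∀ p q, s(x p, y p) = s(x q, y q) → p = q := fun p q h =>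
    g.injective (Subtype.ext (by rw [hxy, hxy, h]))
  have hxy_iff : ∀ p q, G.Adj (x p) (y q) ↔ p = q := by
    refine fun p q => ⟨fun h => hinj p q ?_, by rintro rfl; exact hadj p⟩
    have h1 := hmatch _ (hxD p) _ (hyD q) _ (hxD q) h (hadj q).symm
    have h2 := hmatch _ (hyD p) _ (hxD p) _ (hyD q) (hadj p).symm h
    rw [h1, h2]
  have hyy : ∀ p q, ¬ G.Adj (y p) (y q) := by
    intro p q h
    have h1 := hmatch _ (hxD p) _ (hyD p) _ (hyD q) (hadj p) h
    have h2 := hmatch _ (hyD p) _ (hyD q) _ (hxD q) h (hadj q).symm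
    obtain rfl := hinj p q (by rw [h1, h2, Sym2.eq_swap])
    exact G.loopless.irrefl _ h
  have hxx : ∀ p q, ¬ G.Adj (x p) (x q) := by
    intro p q h
    have h1 := hmatch _ (hyD p) _ (hxD p) _ (hxD q) (hadj p).symm h
    have h2 := hmatch _ (hxD p) _ (hxD q) _ (hyD q) h (hadj q)
    obtain rfl := hinj p q (by rw [h1, h2, Sym2.eq_swap])
    exact G.loopless.irrefl _ h
  have hyinj : ∀ p q, y p = y q → p = q := fun p q h =>
    (hxy_iff p q).1 (h ▸ hadj p)
  have hxney : ∀ p q, x p ≠ y q := fun p q h => hyy q p (h ▸ hadj p)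
  obtain ⟨w, hw, hww⟩ := exists_independent_representatives
    (fun i => Set.range fun t => y (i, t)) hAP3 hAdom hnoP3 hD
    (by rintro i _ ⟨t, rfl⟩; exact hyD _)
    (fun i => by
      rw [← Set.image_univ, Set.ncard_image_of_injective _ fun s t h => by
        simpa using hyinj _ _ h]
      simp [Set.ncard_univ])
  have hwx : ∀ i p, ¬ G.Adj (w i) (x p) := fun i p h => by
    obtain ⟨t, ht⟩ := (hw i).2 _ (hxD p) h
    exact hxney _ _ ht.symm
  have hwy : ∀ i p, G.Adj (w i) (y p) → i = p.1 := fun i p h => by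
    obtain ⟨t, ht⟩ := (hw i).2 _ (hyD p) h
    exact congrArg Prod.fst (hyinj _ _ ht)
  have htwo : ∀ i, ∃ s t, s ≠ t ∧ G.Adj (w i) (y (i, s)) ∧ G.Adj (w i) (y (i, t)) := by
    intro i
    obtain ⟨u, hu, huw⟩ := hD.1 (w i)
    obtain ⟨s, rfl⟩ := (hw i).2 u hu huw
    by_contra! hcon
    refine hpriv (i, s) ⟨w i, (hw i).1, Or.inr (Set.eq_singleton_iff_unique_mem.2
      ⟨⟨hu, huw⟩, ?_⟩)⟩
    rintro v ⟨hv, hvw⟩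
    obtain ⟨t, rfl⟩ := (hw i).2 v hv hvw
    by_contra hne
    exact hcon s t (fun h => hne (by rw [h])) huw hvw
  choose s t hst hs ht using htwo
  obtain ⟨ψ⟩ := nonempty_kCopies_embedding_of_paths (G := G)
    (fun i => x (i, s i)) (fun i => y (i, s i)) w (fun i => y (i, t i))
    (fun _ _ => hxx _ _)
    (fun i j => by
      rw [hxy_iff]
      exact ⟨congrArg Prod.fst, by rintro rfl; rfl⟩)
    (fun _ _ h => hwx _ _ h.symm)
    (fun i j h => by
      rw [hxy_iff, Prod.mk.injEq] at h
      obtain ⟨rfl, h⟩ := h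
      exact hst i h)
    (fun _ _ => hyy _ _)
    (fun i j => ⟨fun h => (hwy _ _ h.symm).symm, by rintro rfl; exact (hs i).symm⟩)
    (fun _ _ => hyy _ _) hww
    (fun i j => ⟨fun h => hwy _ _ h, by rintro rfl; exact ht i⟩)
    (fun _ _ => hyy _ _)
  exact hfree ⟨(p4kp3EmbeddingKCopies k).trans ψ⟩
end

section
/- Under the (P4+kP3)-free setup, suppose that no minimum total dominating set of G contains a P3, and let D be a minimum total dominating set of G. Let x_1y_1 and x_2y_2 be two distinct C-edges of D contained in distinct cliques K_1, K_2 ∈ 𝒦 respectively. If G[N[K_1]] and G[N[K_2]] both contain no induced P4, then K_1 and K_2 have distance at least four from one another. -/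
open SimpleGraph

open TD SimpleGraph


namespace TD

/-- Four vertices inducing a path give an induced copy of `P4`. -/
lemma not_indFree_pathGraph_four {V : Type*} {G : SimpleGraph V} {a b c d : V}
    (hab : G.Adj a b) (hbc : G.Adj b c) (hcd : G.Adj c d)
    (hac : ¬ G.Adj a c) (had : ¬ G.Adj a d) (hbd : ¬ G.Adj b d) :
    ¬ IndFree G (pathGraph 4) := by
  have nac : a ≠ c := by rintro rfl; exact had hcd
  have nad : a ≠ d := by rintro rfl; exact hac hcd.symm
  have nbd : b ≠ d := by rintro rfl; exact had hab
  have hinj : Function.Injective ![a, b, c, d] := by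
    intro i j hij
    have := hab.ne
    have := hbc.ne
    have := hcd.ne
    fin_cases i <;> fin_cases j <;> simp_all
  have hadj : ∀ i j, G.Adj (![a, b, c, d] i) (![a, b, c, d] j) ↔ (pathGraph 4).Adj i j := by
    intro i j
    have hca : ¬ G.Adj c a := fun h => hac h.symm
    have hda : ¬ G.Adj d a := fun h => had h.symm
    have hdb : ¬ G.Adj d b := fun h => hbd h.symm
    fin_cases i <;> fin_cases j <;>
      simp [pathGraph_adj, hab.symm, hbc.symm, hcd.symm, *]
  exact fun h => h ⟨⟨⟨_, hinj⟩, hadj _ _⟩⟩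

/-- If the closed neighborhood of a clique `K` is `P4`-free, then every neighbor `b` of `K`
forms with some vertex of `K` a pair totally dominating that closed neighborhood. -/
lemma exists_mem_totally_dominating_pair {V : Type*} [Finite V] {G : SimpleGraph V} {K : Set V}
    (hK : G.IsClique K) (hfree : IndFree (G.induce (closedNbhd G K)) (pathGraph 4))
    {b c : V} (hc : c ∈ K) (hcb : G.Adj c b) :
    ∃ u ∈ K, ∀ w ∈ closedNbhd G K, G.Adj w u ∨ G.Adj w b := by
  have noP4 : ∀ {p q r s : V}, p ∈ closedNbhd G K → q ∈ closedNbhd G K → r ∈ closedNbhd G K →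
      s ∈ closedNbhd G K → G.Adj p q → G.Adj q r → G.Adj r s → ¬ G.Adj p r → ¬ G.Adj p s →
      ¬ G.Adj q s → False := fun {p q r s} hp hq hr hs h1 h2 h3 h4 h5 h6 =>
    not_indFree_pathGraph_four (G := G.induce (closedNbhd G K))
      (a := ⟨p, hp⟩) (b := ⟨q, hq⟩) (c := ⟨r, hr⟩) (d := ⟨s, hs⟩) h1 h2 h3 h4 h5 h6 hfree
  have hbN : b ∈ closedNbhd G K := Or.inr ⟨c, hc, hcb⟩
  obtain ⟨u, ⟨huK, hub⟩, hmax⟩ := Set.exists_max_image {u | u ∈ K ∧ G.Adj u b}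
    (fun u => (G.neighborSet u ∪ G.neighborSet b).ncard) (Set.toFinite _) ⟨c, hc, hcb⟩
  refine ⟨u, huK, fun w hw => ?_⟩
  by_contra! hcon
  obtain ⟨hwu, hwb⟩ := hcon
  have hwK : w ∉ K := fun h => by
    rcases eq_or_ne w u with rfl | hne
    · exact hwb hub
    · exact hwu (hK h huK hne)
  obtain ⟨u', hu'K, hu'w⟩ : ∃ u' ∈ K, G.Adj u' w := hw.resolve_left hwK
  have hne : u' ≠ u := by rintro rfl; exact hwu hu'w.symm
  have huu' : G.Adj u' u := hK hu'K huK hne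
  have hu'b : G.Adj u' b := by
    by_contra h
    exact noP4 hw (Or.inl hu'K) (Or.inl huK) hbN hu'w.symm huu' hub hwu hwb h
  obtain ⟨w', hw'u, hw'⟩ : ∃ w', G.Adj u w' ∧ ¬ (G.Adj u' w' ∨ G.Adj b w') := by
    by_contra! hall
    refine (hmax u' ⟨hu'K, hu'b⟩).not_gt (Set.ncard_lt_ncard ?_ (Set.toFinite _))
    refine (Set.ssubset_iff_of_subset ?_).2 ⟨w, Or.inl hu'w, ?_⟩
    · rintro z (hz | hz)
      · exact hall z hz
      · exact Or.inr hz
    · rintro (h | h)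
      · exact hwu h.symm
      · exact hwb h.symm
  push Not at hw'
  have hw'N : w' ∈ closedNbhd G K := Or.inr ⟨u, huK, hw'u⟩
  by_cases hww' : G.Adj w w'
  · exact noP4 hbN (Or.inl huK) hw'N hw hub.symm hw'u hww'.symm hw'.2 (fun h => hwb h.symm)
      (fun h => hwu h.symm)
  · exact noP4 hw (Or.inl hu'K) (Or.inl huK) hw'N hu'w.symm huu' hw'u hwu hww' hw'.1

/-- An induced `P3` among vertices anticomplete to an induced `P4 + mP3` extends it to an induced
`P4 + (m + 1)P3`. -/
lemma not_indFree_p4kp3_succ {V : Type*} {G : SimpleGraph V} {A : Set V} {m : ℕ}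
    (e : p4kp3 m ↪g G.induce A) {u w v : V} (huw : G.Adj u w) (hwv : G.Adj w v)
    (huv : ¬ G.Adj u v) (hne : u ≠ v)
    (hanti : ∀ z, z = u ∨ z = w ∨ z = v → z ∉ A ∧ ∀ a ∈ A, ¬ G.Adj z a) :
    ¬ IndFree G (p4kp3 (m + 1)) := by
  have hp : ∀ t : Fin 3, ![u, w, v] t = u ∨ ![u, w, v] t = w ∨ ![u, w, v] t = v := by
    intro t; fin_cases t <;> simp
  have hpe : ∀ (t : Fin 3) x, ![u, w, v] t ≠ (e x : V) := fun t x h =>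
    (hanti _ (hp t)).1 (h ▸ (e x).2)
  have hpa : ∀ (t : Fin 3) x, ¬ G.Adj (![u, w, v] t) (e x : V) := fun t x =>
    (hanti _ (hp t)).2 _ (e x).2
  have hpa' : ∀ (t : Fin 3) x, ¬ G.Adj (e x : V) (![u, w, v] t) := fun t x h => hpa t x h.symm
  have hpinj : Function.Injective ![u, w, v] := by
    intro i j hij
    have := huw.ne
    have := hwv.ne
    fin_cases i <;> fin_cases j <;> simp_all
  have hpadj : ∀ s t : Fin 3, G.Adj (![u, w, v] s) (![u, w, v] t) ↔ (pathGraph 3).Adj s t := by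
    intro s t
    have : ¬ G.Adj v u := fun h => huv h.symm
    fin_cases s <;> fin_cases t <;> simp [pathGraph_adj, huw.symm, hwv.symm, *]
  have he : ∀ x y, G.Adj (e x : V) (e y) ↔ (p4kp3 m).Adj x y := fun x y => e.map_rel_iff
  have heinj : ∀ x y, (e x : V) = e y ↔ x = y := fun x y => by
    rw [Subtype.coe_inj, e.injective.eq_iff]
  let f : Fin 4 ⊕ (Fin (m + 1) × Fin 3) → V := Sum.elim (fun i => (e (Sum.inl i) : V))
    (fun p => Fin.lastCases (motive := fun _ => V) (![u, w, v] p.2)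
      (fun j => (e (Sum.inr (j, p.2)) : V)) p.1)
  have f1 : ∀ i, f (Sum.inl i) = e (Sum.inl i) := fun i => rfl
  have f2 : ∀ t, f (Sum.inr (Fin.last m, t)) = ![u, w, v] t := fun t => by simp [f]
  have f3 : ∀ (j : Fin m) t, f (Sum.inr (j.castSucc, t)) = e (Sum.inr (j, t)) := fun j t => by
    simp [f]
  have hcl : ∀ j : Fin m, j.castSucc ≠ Fin.last m := fun j => (Fin.castSucc_lt_last j).ne
  have hfinj : Function.Injective f := by
    rintro (i | ⟨j, t⟩) (i' | ⟨j', t'⟩) hij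
    · rw [f1, f1, heinj] at hij
      rw [Sum.inl.inj hij]
    · induction j' using Fin.lastCases with
      | last => rw [f1, f2] at hij; exact absurd hij.symm (hpe _ _)
      | cast j' => rw [f1, f3, heinj] at hij; simp at hij
    · induction j using Fin.lastCases with
      | last => rw [f1, f2] at hij; exact absurd hij (hpe _ _)
      | cast j => rw [f1, f3, heinj] at hij; simp at hij
    · induction j using Fin.lastCases with
      | last =>
        induction j' using Fin.lastCases with
        | last => rw [f2, f2] at hij; rw [hpinj hij]
        | cast j' => rw [f2, f3] at hij; exact absurd hij (hpe _ _)
      | cast j =>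
        induction j' using Fin.lastCases with
        | last => rw [f2, f3] at hij; exact absurd hij.symm (hpe _ _)
        | cast j' =>
          rw [f3, f3, heinj] at hij
          simp only [Sum.inr.injEq, Prod.mk.injEq] at hij
          rw [hij.1, hij.2]
  have hfadj : ∀ x y, G.Adj (f x) (f y) ↔ (p4kp3 (m + 1)).Adj x y := by
    rintro (i | ⟨j, t⟩) (i' | ⟨j', t'⟩)
    · rw [f1, f1, he]; simp [p4kp3]
    · induction j' using Fin.lastCases with
      | last => rw [f1, f2]; exact iff_of_false (hpa' _ _) (by simp [p4kp3])
      | cast j' => rw [f1, f3, he]; simp [p4kp3]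
    · induction j using Fin.lastCases with
      | last => rw [f1, f2]; exact iff_of_false (hpa _ _) (by simp [p4kp3])
      | cast j => rw [f1, f3, he]; simp [p4kp3]
    · induction j using Fin.lastCases with
      | last =>
        induction j' using Fin.lastCases with
        | last => rw [f2, f2, hpadj]; simp [p4kp3, kCopies]
        | cast j' => rw [f2, f3]; exact iff_of_false (hpa _ _) (by simp [p4kp3, kCopies, (hcl _).symm])
      | cast j =>
        induction j' using Fin.lastCases with
        | last => rw [f2, f3]; exact iff_of_false (hpa' _ _) (by simp [p4kp3, kCopies, hcl _])
        | cast j' => rw [f3, f3, he]; simp [p4kp3, kCopies]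
  exact fun h => h ⟨⟨⟨f, hfinj⟩, hfadj _ _⟩⟩

/-- If the induced subgraph on `C` has no induced `P3`, distinct maximal cliques are disjoint. -/
lemma IsMaxCliqueWithin.disjoint {V : Type*} {G : SimpleGraph V} {C K₁ K₂ : Set V}
    (hC : ∀ u ∈ C, ∀ w ∈ C, ∀ v ∈ C, G.Adj u w → G.Adj w v → u ≠ v → G.Adj u v)
    (hK₁ : IsMaxCliqueWithin G C K₁) (hK₂ : IsMaxCliqueWithin G C K₂) (hne : K₁ ≠ K₂) :
    Disjoint K₁ K₂ := by
  rw [Set.disjoint_left]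
  intro w hw₁ hw₂
  refine hne (hK₂.2.2 K₁ hK₁.1 hK₁.2.1 ?_)
  intro v hv
  have hins : G.IsClique (insert v K₁) := hK₁.2.1.insert fun u hu hvu => by
    rcases eq_or_ne v w with rfl | hvw
    · exact hK₁.2.1 hw₁ hu hvu
    rcases eq_or_ne w u with rfl | hwu
    · exact hK₂.2.1 hv hw₂ hvu
    exact hC v (hK₂.1 hv) w (hK₁.1 hw₁) u (hK₁.1 hu) (hK₂.2.1 hv hw₂ hvw)
      (hK₁.2.1 hw₁ hu hwu) hvu
  have := hK₁.2.2 _ (Set.insert_subset (hK₂.1 hv) hK₁.1) hins (Set.subset_insert _ _)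
  exact this ▸ Set.mem_insert _ _

/-- Replacing part of a minimum total dominating set by a set that is not larger and totally
dominates all vertices dominated by that part gives a minimum total dominating set. -/
lemma IsMinTotalDomSet.exchange {V : Type*} [Finite V] {G : SimpleGraph V} {D S T : Set V}
    (hD : IsMinTotalDomSet G D) (hS : S ⊆ D) (hST : T.ncard ≤ S.ncard)
    (hT : ∀ s ∈ S, ∀ w, G.Adj w s → ∃ t ∈ T, G.Adj w t) :
    IsMinTotalDomSet G (D \ S ∪ T) ∧ T.ncard = S.ncard := by
  have htot : IsTotalDomSet G (D \ S ∪ T) := fun w => by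
    obtain ⟨d, hd, hwd⟩ := hD.1 w
    by_cases hdS : d ∈ S
    · obtain ⟨t, ht, hwt⟩ := hT d hdS w hwd
      exact ⟨t, Or.inr ht, hwt⟩
    · exact ⟨d, Or.inl ⟨hd, hdS⟩, hwd⟩
  have hle : totalDomNum G ≤ (D \ S ∪ T).ncard := Nat.sInf_le ⟨_, htot, rfl⟩
  have h1 := Set.ncard_union_le (D \ S) T
  have h2 := Set.ncard_sdiff_add_ncard_of_subset hS (Set.toFinite D)
  have h3 := hD.2
  exact ⟨⟨htot, by omega⟩, by omega⟩

end TD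

theorem stmt16 {V : Type*} [Fintype V] (k : ℕ) (hk : 1 ≤ k)
    (G : SimpleGraph V) (hconn : G.Connected) (hfree : IndFree G (p4kp3 k))
    (A B C : Set V) (hA : Nonempty (G.induce A ≃g p4kp3 (k - 1)))
    (hB : B = {v | v ∉ A ∧ ∃ a ∈ A, G.Adj v a})
    (hC : C = {v | v ∉ A ∧ v ∉ B})
    (hnoP3 : ∀ D' : Set V, IsMinTotalDomSet G D' → ¬ HasP3 G D')
    (D : Set V) (hD : IsMinTotalDomSet G D)
    (K₁ K₂ : Set V) (hK₁ : IsMaxCliqueWithin G C K₁) (hK₂ : IsMaxCliqueWithin G C K₂)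
    (hne : K₁ ≠ K₂)
    (x₁ y₁ x₂ y₂ : V)
    (hx₁ : x₁ ∈ K₁) (hy₁ : y₁ ∈ K₁) (hx₂ : x₂ ∈ K₂) (hy₂ : y₂ ∈ K₂)
    (hx₁D : x₁ ∈ D) (hy₁D : y₁ ∈ D) (hx₂D : x₂ ∈ D) (hy₂D : y₂ ∈ D)
    (hadj₁ : G.Adj x₁ y₁) (hadj₂ : G.Adj x₂ y₂)
    (hfree₁ : IndFree (G.induce (closedNbhd G K₁)) (pathGraph 4))
    (hfree₂ : IndFree (G.induce (closedNbhd G K₂)) (pathGraph 4)) :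
    4 ≤ setDist G K₁ K₂ := by
  obtain ⟨m, rfl⟩ : ∃ m, k = m + 1 := ⟨k - 1, by omega⟩
  obtain ⟨e⟩ := hA
  have hanti : ∀ z ∈ C, z ∉ A ∧ ∀ a ∈ A, ¬ G.Adj z a := by
    subst hC hB
    exact fun z hz => ⟨hz.1, fun a ha h => hz.2 ⟨hz.1, a, ha, h⟩⟩
  have hP3 : ∀ u ∈ C, ∀ w ∈ C, ∀ v ∈ C, G.Adj u w → G.Adj w v → u ≠ v → G.Adj u v := by
    intro u hu w hw v hv huw hwv huv
    by_contra h
    refine not_indFree_p4kp3_succ e.symm.toEmbedding huw hwv h huv ?_ hfree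
    rintro z (rfl | rfl | rfl)
    exacts [hanti _ hu, hanti _ hw, hanti _ hv]
  have hdisj := hK₁.disjoint hP3 hK₂ hne
  have h12 : ∀ {z}, z ∈ K₁ → z ∉ K₂ := fun h h' => Set.disjoint_left.1 hdisj h h'
  have h21 : ∀ {z}, z ∈ K₂ → z ∉ K₁ := fun h h' => h12 h' h
  have hScard : ({x₁, y₁, x₂, y₂} : Set V).ncard = 4 := by
    have e1 : x₁ ≠ x₂ := fun h => h12 hx₁ (h ▸ hx₂)
    have e2 : x₁ ≠ y₂ := fun h => h12 hx₁ (h ▸ hy₂)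
    have e3 : y₁ ≠ x₂ := fun h => h12 hy₁ (h ▸ hx₂)
    have e4 : y₁ ≠ y₂ := fun h => h12 hy₁ (h ▸ hy₂)
    rw [Set.ncard_insert_of_notMem (by simp [hadj₁.ne, *]),
      Set.ncard_insert_of_notMem (by simp [*]), Set.ncard_pair hadj₂.ne]
  have key : ∀ T : Set V, T.ncard ≤ 4 →
      (∀ w ∈ closedNbhd G K₁, ∃ t ∈ T, G.Adj w t) →
      (∀ w ∈ closedNbhd G K₂, ∃ t ∈ T, G.Adj w t) → T.ncard = 4 ∧ ¬ HasP3 G T := by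
    intro T hT h1 h2
    obtain ⟨hmin, hcard⟩ := hD.exchange (S := {x₁, y₁, x₂, y₂}) (T := T)
      (by rintro z (rfl | rfl | rfl | rfl) <;> assumption) (by omega) (by
        rintro s (rfl | rfl | rfl | rfl) w hw
        · exact h1 w (Or.inr ⟨_, hx₁, hw.symm⟩)
        · exact h1 w (Or.inr ⟨_, hy₁, hw.symm⟩)
        · exact h2 w (Or.inr ⟨_, hx₂, hw.symm⟩)
        · exact h2 w (Or.inr ⟨_, hy₂, hw.symm⟩))
    refine ⟨by omega, ?_⟩
    rintro ⟨a, b, c, ha, hb, hc, h⟩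
    exact hnoP3 _ hmin ⟨a, b, c, Or.inr ha, Or.inr hb, Or.inr hc, h⟩
  have pair₁ : ∀ {b c}, c ∈ K₁ → G.Adj c b →
      ∃ u ∈ K₁, ∀ w ∈ closedNbhd G K₁, G.Adj w u ∨ G.Adj w b :=
    exists_mem_totally_dominating_pair hK₁.2.1 hfree₁
  have pair₂ : ∀ {b c}, c ∈ K₂ → G.Adj c b →
      ∃ u ∈ K₂, ∀ w ∈ closedNbhd G K₂, G.Adj w u ∨ G.Adj w b :=
    exists_mem_totally_dominating_pair hK₂.2.1 hfree₂
  have card3 : ∀ a b c : V, ({a, b, c} : Set V).ncard ≤ 3 := fun a b c =>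
    (Set.ncard_insert_le _ _).trans (Nat.succ_le_succ ((Set.ncard_insert_le _ _).trans (by simp)))
  have card4 : ∀ a b c d : V, ({a, b, c, d} : Set V).ncard ≤ 4 := fun a b c d =>
    (Set.ncard_insert_le _ _).trans (Nat.succ_le_succ (card3 b c d))
  -- In each case `{u, p, q, v}` replaces the two `C`-edges.
  have main : ∀ {p q u v : V}, (∀ w ∈ closedNbhd G K₁, G.Adj w u ∨ G.Adj w p) →
      (∀ w ∈ closedNbhd G K₂, G.Adj w v ∨ G.Adj w q) →
      ({u, p, q, v} : Set V).ncard = 4 ∧ ¬ HasP3 G {u, p, q, v} := by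
    intro p q u v hu hv
    refine key _ (card4 _ _ _ _) (fun w hw => ?_) (fun w hw => ?_)
    · rcases hu w hw with h | h
      exacts [⟨u, by simp, h⟩, ⟨p, by simp, h⟩]
    · rcases hv w hw with h | h
      exacts [⟨v, by simp, h⟩, ⟨q, by simp, h⟩]
  have no1 : ∀ a ∈ K₁, ∀ b ∈ K₂, ¬ G.Adj a b := by
    intro a ha b hb hab
    obtain ⟨u, huK, hu⟩ := pair₁ ha hab
    obtain ⟨v, hvK, hv⟩ := pair₂ hb hab.symm
    obtain ⟨hcard, hno⟩ := main hu hv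
    rcases eq_or_ne b v with rfl | hbv
    · have heq : ({u, b, a, b} : Set V) = {u, b, a} := by ext; simp; tauto
      have := card3 u b a
      rw [heq] at hcard
      omega
    · have hva : G.Adj v a := (hv v (Or.inl hvK)).resolve_left (G.irrefl)
      exact hno ⟨b, a, v, by simp, by simp, by simp, hab.ne', hva.ne', hbv, hab.symm, hva.symm⟩
  have no2 : ∀ a ∈ K₁, ∀ c, ∀ b ∈ K₂, G.Adj a c → ¬ G.Adj c b := by
    intro a ha c b hb hac hcb
    obtain ⟨u, huK, hu⟩ := pair₁ ha hac
    obtain ⟨v, hvK, hv⟩ := pair₂ hb hcb.symm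
    have hcard := (main hu hv).1
    rw [Set.insert_eq_of_mem (show c ∈ ({c, v} : Set V) by simp)] at hcard
    have := card3 u c v
    omega
  have no3 : ∀ a ∈ K₁, ∀ c d, ∀ b ∈ K₂, G.Adj a c → G.Adj c d → ¬ G.Adj d b := by
    intro a ha c d b hb hac hcd hdb
    have hd1 : d ∉ K₁ := fun h => no1 d h b hb hdb
    obtain ⟨u, huK, hu⟩ := pair₁ ha hac
    obtain ⟨v, hvK, hv⟩ := pair₂ hb hdb.symm
    have huc : G.Adj u c := (hu u (Or.inl huK)).resolve_left (G.irrefl)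
    exact (main hu hv).2 ⟨u, c, d, by simp, by simp, by simp, huc.ne, hcd.ne,
      fun h => hd1 (h ▸ huK), huc, hcd⟩
  obtain ⟨a, ha, b, hb, hdist⟩ : setDist G K₁ K₂ ∈
      {m : ℕ | ∃ u ∈ K₁, ∃ v ∈ K₂, G.dist u v = m} :=
    Nat.sInf_mem ⟨_, x₁, hx₁, x₂, hx₂, rfl⟩
  obtain ⟨p, hp⟩ := hconn.exists_walk_length_eq_dist a b
  rw [← hdist, ← hp]
  rcases p with _ | ⟨h1, _ | ⟨h2, _ | ⟨h3, _ | ⟨h4, p⟩⟩⟩⟩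
  · exact absurd hb (h12 ha)
  · exact absurd h1 (no1 _ ha _ hb)
  · exact absurd h2 (no2 _ ha _ _ hb h1)
  · exact absurd h3 (no3 _ ha _ _ _ hb h1 h2)
  · simp only [Walk.length_cons]
    omega
end
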